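/- (Lemma 1) Let (D, R, w, c, (R_i), (D_j)) be a resource allocation instance and let (o_t, s_t)_{t ∈ ℕ} be a fair REACT execution. Suppose S ⊆ R with |S| < |R|, and there is a time T₀ such that for all t ≥ T₀ and all j ∈ S, o_t j = o_{T₀} j and o_t j ≤ o_t j' for all j' ∈ R. Then there exist a resource j* ∈ R \ S and a time T ≥ T₀ such that for all t ≥ T, o_t j* = o_T j* and o_T j* ≤ o_t j' for every j' ∈ R \ S. -/

import Mathlib

open Classical Finset

/-- A resource allocation instance: finite sets `D` of demands and `R` of resources,
nonnegative demand magnitudes `w`, nonnegative capacities `c`, and for each demand `i`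
a nonempty set `Ri i` of required resources, such that every resource is required by
at least one demand. -/
structure RAInstance (D R : Type*) [Fintype D] [Fintype R] where
  w : D → ℝ
  c : R → ℝ
  Ri : D → Finset R
  w_nonneg : ∀ i, 0 ≤ w i
  c_nonneg : ∀ j, 0 ≤ c j
  Ri_nonempty : ∀ i, (Ri i).Nonempty
  Dj_nonempty : ∀ j : R, (Finset.univ.filter fun i => j ∈ Ri i).Nonempty

variable {D R : Type*} [Fintype D] [Fintype R]

/-- The set `D_j` of demands requiring resource `j`. -/
noncomputable def RAInstance.Dj (I : RAInstance D R) (j : R) : Finset D :=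
  Finset.univ.filter fun i => j ∈ I.Ri i

theorem RAInstance.Dj_nonempty' (I : RAInstance D R) (j : R) : (I.Dj j).Nonempty :=
  I.Dj_nonempty j

/-- `o` is an auction offer for claims `x` on the nonempty finite bidder set `B` with
capacity `c`: with `B* = {b ∈ B : x b < o}` and `A = c - ∑_{b ∈ B*} x b`, we have
`o = A / |B \ B*|` when `B* ≠ B`, and `o = A + max {x b : b ∈ B}` when `B* = B`. -/
def IsAuctionOffer {ι : Type*} (B : Finset ι) (hB : B.Nonempty) (x : ι → ℝ) (c o : ℝ) : Prop :=
  let Bs := B.filter fun b => x b < o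
  let A := c - ∑ b ∈ Bs, x b
  if Bs = B then o = A + B.sup' hB x
  else o = A / ((B \ Bs).card : ℝ)

/-- A stable configuration `(s, o)`: every claim is the minimum of the demand magnitude
and the smallest adjacent offer, and every offer is an auction offer for the adjacent
claims. -/
def IsStableConfig (I : RAInstance D R) (s : D → ℝ) (o : R → ℝ) : Prop :=
  (∀ i, s i = min (I.w i) ((I.Ri i).inf' (I.Ri_nonempty i) o)) ∧
  ∀ j, IsAuctionOffer (I.Dj j) (I.Dj_nonempty' j) s (I.c j) (o j)


/-- A fair REACT execution: at each step the scheduled demand updates its claim to the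
minimum of its magnitude and its smallest adjacent offer, or the scheduled resource
updates its offer to the auction offer for the adjacent claims; everything else is
unchanged, and every demand and resource is scheduled infinitely often. -/
structure ReactExecution (I : RAInstance D R) where
  o : ℕ → R → ℝ
  s : ℕ → D → ℝ
  sched : ℕ → D ⊕ R
  o_init_nonneg : ∀ j, 0 ≤ o 0 j
  s_init_nonneg : ∀ i, 0 ≤ s 0 i
  s_init_le : ∀ i, s 0 i ≤ I.w i
  fair_demand : ∀ (i : D) (t : ℕ), ∃ t', t ≤ t' ∧ sched t' = Sum.inl i
  fair_resource : ∀ (j : R) (t : ℕ), ∃ t', t ≤ t' ∧ sched t' = Sum.inr j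
  step_demand : ∀ t i, sched t = Sum.inl i →
      s (t + 1) i = min (I.w i) ((I.Ri i).inf' (I.Ri_nonempty i) (o t)) ∧
      (∀ i', i' ≠ i → s (t + 1) i' = s t i') ∧ ∀ j, o (t + 1) j = o t j
  step_resource : ∀ t j, sched t = Sum.inr j →
      IsAuctionOffer (I.Dj j) (I.Dj_nonempty' j) (s t) (I.c j) (o (t + 1) j) ∧
      (∀ j', j' ≠ j → o (t + 1) j' = o t j') ∧ ∀ i, s (t + 1) i = s t i

section AuctionOffer

variable {ι : Type*} {B : Finset ι} {hB : B.Nonempty} {x y : ι → ℝ} {c o o' : ℝ}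

/-- An auction offer either distributes the surplus on top of the largest claim, or fills all
claims up to a common level that exhausts the capacity. -/
theorem isAuctionOffer_iff :
    IsAuctionOffer B hB x c o ↔
      (∑ b ∈ B, x b < c ∧ o = c - ∑ b ∈ B, x b + B.sup' hB x) ∨
        (o ≤ B.sup' hB x ∧ ∑ b ∈ B, min (x b) o = c) := by
  have hiff : B.filter (fun b => x b < o) = B ↔ B.sup' hB x < o := by
    rw [Finset.filter_eq_self, Finset.sup'_lt_iff]
  by_cases h : B.filter (fun b => x b < o) = B
  · have hlt := hiff.1 h
    simp only [IsAuctionOffer, h, if_true]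
    constructor
    · intro ho
      exact Or.inl ⟨by linarith, ho⟩
    · rintro (⟨-, ho⟩ | ⟨ho, -⟩)
      · exact ho
      · exact absurd hlt (not_lt.2 ho)
  · have hle : o ≤ B.sup' hB x := not_lt.1 fun hlt => h (hiff.2 hlt)
    simp only [IsAuctionOffer, h, if_false]
    have hne : (B \ B.filter fun b => x b < o).Nonempty := by
      rw [Finset.sdiff_nonempty]
      exact fun hsub => h (Finset.Subset.antisymm (Finset.filter_subset _ _) hsub)
    have hpos : (0 : ℝ) < ((B \ B.filter fun b => x b < o).card : ℝ) := by
      exact_mod_cast hne.card_pos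
    have hsum : ∑ b ∈ B, min (x b) o =
        ((B \ B.filter fun b => x b < o).card : ℝ) * o +
          ∑ b ∈ B.filter (fun b => x b < o), x b := by
      rw [← Finset.sum_sdiff (Finset.filter_subset (fun b => x b < o) B)]
      congr 1
      · rw [← nsmul_eq_mul, ← Finset.sum_const]
        refine Finset.sum_congr rfl fun b hb => min_eq_right ?_
        simp only [Finset.mem_sdiff, Finset.mem_filter, not_and, not_lt] at hb
        exact hb.2 hb.1
      · exact Finset.sum_congr rfl fun b hb => min_eq_left (Finset.mem_filter.1 hb).2.le
    rw [eq_div_iff hpos.ne', hsum]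
    constructor
    · intro ho
      exact Or.inr ⟨hle, by linarith⟩
    · rintro (⟨hc, ho⟩ | ⟨-, ho⟩) <;> linarith

theorem IsAuctionOffer.nonneg (h : IsAuctionOffer B hB x c o) (hx : ∀ b ∈ B, 0 ≤ x b)
    (hc : 0 ≤ c) : 0 ≤ o := by
  obtain ⟨b, hb⟩ := hB
  by_contra! ho
  rcases isAuctionOffer_iff.1 h with ⟨h1, h2⟩ | ⟨-, h2⟩
  · have := (hx b hb).trans (Finset.le_sup' x hb)
    linarith
  · have : ∑ b ∈ B, min (x b) o < 0 :=
      Finset.sum_neg (fun b _ => (min_le_right _ _).trans_lt ho) ⟨b, hb⟩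
    linarith

/-- Auction offers are antitone in the claims. -/
theorem IsAuctionOffer.le_of_le (h : IsAuctionOffer B hB x c o) (h' : IsAuctionOffer B hB y c o')
    (hyx : ∀ b ∈ B, y b ≤ x b) : o ≤ o' := by
  by_contra! hlt
  obtain ⟨b, hb, hbx⟩ := B.exists_mem_eq_sup' hB x
  have hyb : y b ≤ B.sup' hB y := Finset.le_sup' y hb
  have hsum := Finset.sum_le_sum hyx
  rcases isAuctionOffer_iff.1 h with ⟨h1, h2⟩ | ⟨h1, h2⟩ <;>
    rcases isAuctionOffer_iff.1 h' with ⟨h3, h4⟩ | ⟨h3, h4⟩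
  · have := Finset.sum_le_sum fun a (ha : a ∈ B.erase b) => hyx a (Finset.mem_of_mem_erase ha)
    have := Finset.add_sum_erase B x hb
    have := Finset.add_sum_erase B y hb
    linarith
  · have := Finset.sum_le_sum fun a (_ : a ∈ B) => min_le_left (y a) o'
    linarith
  · have hy : ∀ a ∈ B, y a ≤ o := fun a ha => by
      have := Finset.le_sup' y ha
      linarith
    have := Finset.sum_le_sum fun a (ha : a ∈ B.erase b) =>
      le_min (hyx a (Finset.mem_of_mem_erase ha)) (hy a (Finset.mem_of_mem_erase ha))
    have := Finset.add_sum_erase B (fun a => min (x a) o) hb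
    have := Finset.add_sum_erase B y hb
    have : min (x b) o = o := min_eq_right (hbx ▸ h1)
    linarith
  · have : ∑ a ∈ B, min (y a) o' < ∑ a ∈ B, min (x a) o := by
      refine Finset.sum_lt_sum (fun a ha => min_le_min (hyx a ha) hlt.le) ⟨b, hb, ?_⟩
      have hxo : min (x b) o = o := min_eq_right (hbx ▸ h1)
      rw [hxo]
      exact (min_le_right _ _).trans_lt hlt
    linarith

/-- An auction offer is unaffected by lowering claims that exceed it, as long as they stay at
least as large as the offer. -/
theorem IsAuctionOffer.of_le_of_min_le (h : IsAuctionOffer B hB x c o)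
    (hyx : ∀ b ∈ B, y b ≤ x b) (hxy : ∀ b ∈ B, min (x b) o ≤ y b) :
    IsAuctionOffer B hB y c o := by
  rcases isAuctionOffer_iff.1 h with ⟨h1, h2⟩ | ⟨h1, h2⟩
  · have heq : ∀ b ∈ B, y b = x b := fun b hb => by
      have := Finset.le_sup' x hb
      have hmin := hxy b hb
      rw [min_eq_left (by linarith)] at hmin
      exact le_antisymm (hyx b hb) hmin
    refine isAuctionOffer_iff.2 (Or.inl ?_)
    rw [Finset.sum_congr rfl heq, Finset.sup'_congr hB rfl heq]
    exact ⟨h1, h2⟩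
  · refine isAuctionOffer_iff.2 (Or.inr ⟨?_, ?_⟩)
    · obtain ⟨b, hb, hbx⟩ := B.exists_mem_eq_sup' hB x
      have := hxy b hb
      rw [min_eq_right (hbx ▸ h1)] at this
      exact this.trans (Finset.le_sup' y hb)
    · rw [← h2]
      exact Finset.sum_congr rfl fun b hb => le_antisymm (min_le_min_right _ (hyx b hb))
        (le_min (hxy b hb) (min_le_right _ _))

theorem exists_isAuctionOffer (hB : B.Nonempty) (hx : ∀ b ∈ B, 0 ≤ x b) (hc : 0 ≤ c) :
    ∃ o, IsAuctionOffer B hB x c o := by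
  rcases lt_or_ge (∑ b ∈ B, x b) c with h | h
  · exact ⟨_, isAuctionOffer_iff.2 (Or.inl ⟨h, rfl⟩)⟩
  · have hsup : 0 ≤ B.sup' hB x := by
      obtain ⟨b, hb⟩ := hB
      exact (hx b hb).trans (Finset.le_sup' x hb)
    have hcont : Continuous fun r : ℝ => ∑ b ∈ B, min (x b) r := by fun_prop
    have h0 : ∑ b ∈ B, min (x b) 0 = 0 :=
      Finset.sum_eq_zero fun b hb => min_eq_right (hx b hb)
    have h1 : ∑ b ∈ B, min (x b) (B.sup' hB x) = ∑ b ∈ B, x b :=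
      Finset.sum_congr rfl fun b hb => min_eq_left (Finset.le_sup' x hb)
    obtain ⟨o, ho, hoc⟩ := intermediate_value_Icc hsup hcont.continuousOn
      (show c ∈ Set.Icc _ _ from ⟨h0.trans_le hc, h.trans_eq h1.symm⟩)
    exact ⟨o, isAuctionOffer_iff.2 (Or.inr ⟨ho.2, hoc⟩)⟩

end AuctionOffer

/-- A property that is established at infinitely many times and, from some time on, is either
established or inherited at each step, eventually always holds. -/
theorem eventually_of_frequently_of_step {P : ℕ → Prop} {A : ℕ → Prop}
    (hA : ∀ t, ∃ t', t ≤ t' ∧ A t') (hset : ∀ᶠ t in Filter.atTop, A t → P (t + 1))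
    (hkeep : ∀ t, ¬ A t → P t → P (t + 1)) : ∀ᶠ t in Filter.atTop, P t := by
  obtain ⟨T, hT⟩ := Filter.eventually_atTop.1 hset
  obtain ⟨t, hTt, ht⟩ := hA T
  refine Filter.eventually_atTop.2 ⟨t + 1, fun n hn => ?_⟩
  induction n, hn using Nat.le_induction with
  | base => exact hT t hTt ht
  | succ n hn ih =>
    by_cases h : A n
    · exact hT n (by omega) h
    · exact hkeep n h ih

namespace ReactExecution

variable {I : RAInstance D R} (E : ReactExecution I)

theorem claim_succ_eq {t : ℕ} {i : D} (h : E.sched t ≠ Sum.inl i) :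
    E.s (t + 1) i = E.s t i := by
  rcases hs : E.sched t with k | j
  · exact (E.step_demand t k hs).2.1 i fun hik => h (by rw [hs, hik])
  · exact (E.step_resource t j hs).2.2 i

theorem offer_succ_eq {t : ℕ} {j : R} (h : E.sched t ≠ Sum.inr j) :
    E.o (t + 1) j = E.o t j := by
  rcases hs : E.sched t with i | k
  · exact (E.step_demand t i hs).2.2 j
  · exact (E.step_resource t k hs).2.1 j fun hjk => h (by rw [hs, hjk])

theorem nonneg (t : ℕ) : (∀ i, 0 ≤ E.s t i) ∧ ∀ j, 0 ≤ E.o t j := by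
  induction t with
  | zero => exact ⟨E.s_init_nonneg, E.o_init_nonneg⟩
  | succ t ih =>
    refine ⟨fun i => ?_, fun j => ?_⟩
    · by_cases h : E.sched t = Sum.inl i
      · rw [(E.step_demand t i h).1]
        exact le_min (I.w_nonneg i) (Finset.le_inf' _ _ fun j _ => ih.2 j)
      · rw [E.claim_succ_eq h]
        exact ih.1 i
    · by_cases h : E.sched t = Sum.inr j
      · exact (E.step_resource t j h).1.nonneg (fun i _ => ih.1 i) (I.c_nonneg j)
      · rw [E.offer_succ_eq h]
        exact ih.2 j

theorem eventually_claim {i : D} {p : ℝ → Prop}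
    (h : ∀ᶠ t in Filter.atTop, p (min (I.w i) ((I.Ri i).inf' (I.Ri_nonempty i) (E.o t)))) :
    ∀ᶠ t in Filter.atTop, p (E.s t i) := by
  refine eventually_of_frequently_of_step (E.fair_demand i) (h.mono fun t ht hs => ?_)
    fun t hs ht => ?_
  · rwa [(E.step_demand t i hs).1]
  · rwa [E.claim_succ_eq hs]

theorem eventually_offer {j : R} {p : ℝ → Prop}
    (h : ∀ᶠ t in Filter.atTop, ∀ o,
      IsAuctionOffer (I.Dj j) (I.Dj_nonempty' j) (E.s t) (I.c j) o → p o) :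
    ∀ᶠ t in Filter.atTop, p (E.o t j) := by
  refine eventually_of_frequently_of_step (E.fair_resource j) (h.mono fun t ht hs => ?_)
    fun t hs ht => ?_
  · exact ht _ (E.step_resource t j hs).1
  · rwa [E.offer_succ_eq hs]

end ReactExecution

/-- Lemma 1: if the offers of the resources in `S ⊊ R` have stabilized and remain the
smallest among all offers from time `T₀` on, then some resource outside `S` converges,
within finite time, on an offer that stays the smallest among offers outside `S`. -/
theorem react_next_smallest_offer_stabilizes
    (I : RAInstance D R) (E : ReactExecution I)
    (S : Finset R) (hS : S.card < Fintype.card R) (T0 : ℕ)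
    (hstable : ∀ t, T0 ≤ t → ∀ j ∈ S, E.o t j = E.o T0 j)
    (hsmallest : ∀ t, T0 ≤ t → ∀ j ∈ S, ∀ j' : R, E.o t j ≤ E.o t j') :
    ∃ jstar : R, jstar ∉ S ∧ ∃ T, T0 ≤ T ∧
      (∀ t, T ≤ t → E.o t jstar = E.o T jstar) ∧
      ∀ t, T ≤ t → ∀ j' : R, j' ∉ S → E.o T jstar ≤ E.o t j' := by
  obtain ⟨k, hk⟩ : ∃ k, k ∉ S := by
    by_contra! h
    exact hS.ne (by rw [Finset.eq_univ_iff_forall.2 h, Finset.card_univ])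
  -- The largest claims possible once the demands adjacent to `S` have settled.
  let x : D → ℝ := fun i =>
    if ∃ j ∈ I.Ri i, j ∈ S then min (I.w i) ((I.Ri i).inf' (I.Ri_nonempty i) (E.o T0)) else I.w i
  have hx0 : ∀ i, 0 ≤ x i := fun i => by
    simp only [x]
    split_ifs
    · exact le_min (I.w_nonneg i) (Finset.le_inf' _ _ fun j _ => (E.nonneg T0).2 j)
    · exact I.w_nonneg i
  have hinf : ∀ t, T0 ≤ t → ∀ i, ∀ j ∈ I.Ri i, j ∈ S →
      (I.Ri i).inf' (I.Ri_nonempty i) (E.o t) = E.o T0 j := fun t ht i j hj hjS =>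
    le_antisymm ((Finset.inf'_le _ hj).trans_eq (hstable t ht j hjS))
      (Finset.le_inf' _ _ fun j' _ => hstable t ht j hjS ▸ hsmallest t ht j hjS j')
  have hclaim : ∀ t, T0 ≤ t → ∀ i, (∃ j ∈ I.Ri i, j ∈ S) →
      min (I.w i) ((I.Ri i).inf' (I.Ri_nonempty i) (E.o t)) = x i := by
    rintro t ht i ⟨j, hj, hjS⟩
    simp only [x]
    rw [if_pos ⟨j, hj, hjS⟩, hinf t ht i j hj hjS, hinf T0 le_rfl i j hj hjS]
  choose g hg using fun j => exists_isAuctionOffer (x := x) (I.Dj_nonempty' j)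
    (fun i _ => hx0 i) (I.c_nonneg j)
  have hge := Filter.eventually_ge_atTop T0
  have hsx : ∀ᶠ t in Filter.atTop, ∀ i, E.s t i ≤ x i := by
    refine Filter.eventually_all.2 fun i => E.eventually_claim (p := (· ≤ x i)) ?_
    filter_upwards [hge] with t ht
    by_cases hi : ∃ j ∈ I.Ri i, j ∈ S
    · exact (hclaim t ht i hi).le
    · simp only [x, if_neg hi]
      exact min_le_left _ _
  have hgo : ∀ᶠ t in Filter.atTop, ∀ j, g j ≤ E.o t j :=
    Filter.eventually_all.2 fun j => E.eventually_offer (p := (g j ≤ ·)) <|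
      hsx.mono fun t ht o ho => (hg j).le_of_le ho fun i _ => ht i
  obtain ⟨jstar, hjstar, hmin⟩ :=
    Finset.exists_min_image (Finset.univ.filter (· ∉ S)) g ⟨k, by simpa using hk⟩
  simp only [Finset.mem_filter, Finset.mem_univ, true_and] at hjstar hmin
  have hxs : ∀ᶠ t in Filter.atTop, ∀ i, min (x i) (g jstar) ≤ E.s t i := by
    refine Filter.eventually_all.2 fun i => E.eventually_claim (p := (min (x i) (g jstar) ≤ ·)) ?_
    filter_upwards [hge, hgo] with t ht hgt
    by_cases hi : ∃ j ∈ I.Ri i, j ∈ S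
    · exact (min_le_left _ _).trans (hclaim t ht i hi).ge
    · simp only [x, if_neg hi]
      exact min_le_min_left _ (Finset.le_inf' _ _ fun j hj =>
        (hmin j fun hjS => hi ⟨j, hj, hjS⟩).trans (hgt j))
  have hstar : ∀ᶠ t in Filter.atTop, E.o t jstar = g jstar := by
    refine E.eventually_offer (p := (· = g jstar)) ?_
    filter_upwards [hsx, hxs] with t h1 h2 o ho
    have hoff := (hg jstar).of_le_of_min_le (fun i _ => h1 i) fun i _ => h2 i
    exact le_antisymm (ho.le_of_le hoff fun _ _ => le_rfl) (hoff.le_of_le ho fun _ _ => le_rfl)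
  obtain ⟨T, hT⟩ := Filter.eventually_atTop.1 (hge.and (hgo.and hstar))
  have hTstar := (hT T le_rfl).2.2
  refine ⟨jstar, hjstar, T, (hT T le_rfl).1, fun t ht => ?_, fun t ht j hj => ?_⟩
  · rw [(hT t ht).2.2, hTstar]
  · rw [hTstar]
    exact (hmin j hj).trans ((hT t ht).2.1 j)
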